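/- arXiv:2410.07547 — 3 statements merged into one kernel-verified Lean document; each statement's English description precedes it below -/
import Mathlib

section
/- Under the all-firing condition — I[1] ≥ θ[1] − λ[1]·v[0], and I[t] ≥ θ[t] − λ[t]·θ[t−1] for every t with 2 ≤ t ≤ T — the temporal gradient contribution weights of the EM-PF model all vanish: ε[i,t] = 0 for all time-steps 1 ≤ t < i ≤ T. (Theorem 4.2, case (i).) -/
/-- Theorem 4.2, case (i): under the all-firing condition, all temporal gradient
contribution weights `ε[i,t] = d[i] * ∏_{j=t+1}^{i} λ[j]·(1 - d[j-1])` of the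
EM-PF model vanish. -/
theorem empf_allfiring_eps_zero
    (T : ℕ) (m s v lam th I d : ℕ → ℝ)
    (hm : ∀ t, 1 ≤ t → t ≤ T → m t = lam t * v (t - 1) + I t)
    (hs : ∀ t, 1 ≤ t → t ≤ T → s t = max (m t - th t) 0)
    (hv : ∀ t, 1 ≤ t → t ≤ T → v t = m t - s t)
    (hd : ∀ t, d t = if th t ≤ m t then 1 else 0)
    (hI1 : I 1 ≥ th 1 - lam 1 * v 0)
    (hIt : ∀ t, 2 ≤ t → t ≤ T → I t ≥ th t - lam t * th (t - 1)) :
    ∀ i t, 1 ≤ t → t < i → i ≤ T →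
      d i * ∏ j ∈ Finset.Icc (t + 1) i, lam j * (1 - d (j - 1)) = 0 := by
  have key : ∀ n, n + 1 ≤ T → th (n + 1) ≤ m (n + 1) := by
    intro n
    induction n with
    | zero =>
      intro h
      have h1 := hm 1 le_rfl h
      simp only [Nat.sub_self] at h1
      simp only [Nat.zero_add]
      linarith
    | succ k ih =>
      intro h
      have hk := ih (by omega)
      have h1 := hm (k + 1 + 1) (by omega) h
      have h2 := hIt (k + 1 + 1) (by omega) h
      have h3 := hs (k + 1) (by omega) (by omega)
      have h4 := hv (k + 1) (by omega) (by omega)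
      rw [max_eq_left (by linarith)] at h3
      have h5 : v (k + 1) = th (k + 1) := by linarith
      simp only [Nat.add_sub_cancel] at h1 h2
      rw [h5] at h1
      linarith
  intro i t ht hti hiT
  have hdt : d t = 1 := by
    obtain ⟨n, rfl⟩ : ∃ n, t = n + 1 := ⟨t - 1, by omega⟩
    rw [hd, if_pos (key n (by omega))]
  rw [Finset.prod_eq_zero (i := t + 1) (Finset.mem_Icc.mpr ⟨le_rfl, hti⟩), mul_zero]
  simp [hdt]
end

section
/- Under the all-firing condition of Theorem 4.2(i), the spike outputs of the EM-PF model admit the closed form s[1] = λ[1]·v[0] + I[1] − θ[1] and s[t] = λ[t]·θ[t−1] + I[t] − θ[t] for every t with 2 ≤ t ≤ T, and all of these values are nonnegative. -/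
/-- Closed form of the spike outputs under the all-firing condition of Theorem 4.2(i):
`s[1] = λ[1]·v[0] + I[1] − θ[1]`, `s[t] = λ[t]·θ[t−1] + I[t] − θ[t]` for `2 ≤ t ≤ T`,
and all these values are nonnegative. -/
theorem empf_allfiring_spike_closed_form
    (T : ℕ) (m s v lam th I : ℕ → ℝ)
    (hm : ∀ t, 1 ≤ t → t ≤ T → m t = lam t * v (t - 1) + I t)
    (hs : ∀ t, 1 ≤ t → t ≤ T → s t = max (m t - th t) 0)
    (hv : ∀ t, 1 ≤ t → t ≤ T → v t = m t - s t)
    (hI1 : I 1 ≥ th 1 - lam 1 * v 0)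
    (hIt : ∀ t, 2 ≤ t → t ≤ T → I t ≥ th t - lam t * th (t - 1)) :
    (1 ≤ T → s 1 = lam 1 * v 0 + I 1 - th 1) ∧
    (∀ t, 2 ≤ t → t ≤ T → s t = lam t * th (t - 1) + I t - th t) ∧
    (∀ t, 1 ≤ t → t ≤ T → 0 ≤ s t) := by
  have key : ∀ t, 1 ≤ t → t ≤ T → th t ≤ m t → s t = m t - th t ∧ v t = th t := by
    intro t h1 h2 h
    have e : s t = m t - th t := by
      rw [hs t h1 h2, max_eq_left (by linarith)]
    exact ⟨e, by rw [hv t h1 h2, e]; ring⟩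
  have one : 1 ≤ T → th 1 ≤ m 1 := by
    intro h
    have := hm 1 le_rfl h
    norm_num at this
    linarith
  have hvt : ∀ t, 1 ≤ t → t ≤ T → th t ≤ m t := by
    intro t h1
    induction t, h1 using Nat.le_induction with
    | base => exact one
    | succ n hn ih =>
      intro h
      have a := (key n hn (by omega) (ih (by omega))).2
      have b := hm (n + 1) (by omega) h
      have c := hIt (n + 1) (by omega) h
      rw [Nat.add_sub_cancel] at b c
      rw [a] at b
      linarith
  refine ⟨?_, ?_, ?_⟩
  · intro h
    have b := hm 1 le_rfl h
    norm_num at b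
    rw [(key 1 le_rfl h (one h)).1, b]
  · intro t h2 h
    have a := (key (t - 1) (by omega) (by omega) (hvt (t - 1) (by omega) (by omega))).2
    rw [(key t (by omega) h (hvt t (by omega) h)).1, hm t (by omega) h, a]
  · intro t h1 h
    rw [hs t h1 h]
    exact le_max_right _ _
end

section
/- Corollary 4.3, case (i) (corrected affine form): consider the BN-EM-PF dynamics m[t] = λ[t]·v[t−1] + I[t], m̂[t] = k[t]·m[t] + c[t], s[t] = max(m̂[t] − θ[t], 0), v[t] = m̂[t] − s[t], with k[t] > 0 for all t. If I[1] ≥ (θ[1] − c[1])/k[1] − λ[1]·v[0] and I[t] ≥ (θ[t] − c[t])/k[t] − λ[t]·θ[t−1] for every t with 2 ≤ t ≤ T, then m̂[t] ≥ θ[t] and v[t] = θ[t] for all 1 ≤ t ≤ T, and consequently the temporal gradient contribution weights vanish: ε[i,t] = 0 for all 1 ≤ t < i ≤ T. -/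
/-- Corollary 4.3, case (i) (corrected affine form): under the BN all-firing condition
with positive slopes `k[t] > 0`, the BN-EM-PF neuron fires at every step
(`m̂[t] ≥ θ[t]`), resets to threshold (`v[t] = θ[t]`), and all temporal gradient
contribution weights `ε[i,t] = d[i]·∏_{j=t+1}^{i} (k[j]·λ[j])·(1 − d[j−1])` vanish. -/
theorem bn_empf_allfiring
    (T : ℕ) (k c lam th I m mhat s v d : ℕ → ℝ)
    (hk : ∀ t, k t > 0)
    (hm : ∀ t, 1 ≤ t → t ≤ T → m t = lam t * v (t - 1) + I t)
    (hmhat : ∀ t, 1 ≤ t → t ≤ T → mhat t = k t * m t + c t)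
    (hs : ∀ t, 1 ≤ t → t ≤ T → s t = max (mhat t - th t) 0)
    (hv : ∀ t, 1 ≤ t → t ≤ T → v t = mhat t - s t)
    (hd : ∀ t, d t = if th t ≤ mhat t then 1 else 0)
    (hI1 : I 1 ≥ (th 1 - c 1) / k 1 - lam 1 * v 0)
    (hIt : ∀ t, 2 ≤ t → t ≤ T → I t ≥ (th t - c t) / k t - lam t * th (t - 1)) :
    (∀ t, 1 ≤ t → t ≤ T → mhat t ≥ th t ∧ v t = th t) ∧
    (∀ i t, 1 ≤ t → t < i → i ≤ T →
      d i * ∏ j ∈ Finset.Icc (t + 1) i, (k j * lam j) * (1 - d (j - 1)) = 0) := by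
  have step : ∀ t, 1 ≤ t → t ≤ T → I t ≥ (th t - c t) / k t - lam t * v (t - 1) →
      mhat t ≥ th t ∧ v t = th t := by
    intro t h1 hT h
    have h2 : (th t - c t) / k t ≤ m t := by
      rw [hm t h1 hT]; linarith
    rw [div_le_iff₀ (hk t)] at h2
    have h3 : mhat t ≥ th t := by
      rw [hmhat t h1 hT]; linarith
    refine ⟨h3, ?_⟩
    rw [hv t h1 hT, hs t h1 hT, max_eq_left (by linarith)]
    ring
  have main : ∀ t, 1 ≤ t → t ≤ T → mhat t ≥ th t ∧ v t = th t := by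
    intro t h1
    induction t, h1 using Nat.le_induction with
    | base => intro hT; exact step 1 le_rfl hT hI1
    | succ n hn ih =>
      intro hT
      apply step (n + 1) (by omega) hT
      have h := hIt (n + 1) (by omega) hT
      simp only [Nat.add_sub_cancel] at h ⊢
      rw [(ih (by omega)).2]
      exact h
  refine ⟨main, ?_⟩
  intro i t h1 hti hi
  have hdt : d t = 1 := by
    rw [hd t, if_pos (main t h1 (by omega)).1]
  rw [Finset.prod_eq_zero (i := t + 1) (Finset.mem_Icc.mpr ⟨le_rfl, hti⟩), mul_zero]
  simp [hdt]
end
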